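/- There exists a unique f ∈ 𝔽 with Tf = f; that is, there is exactly one continuous function f : I → ℝ with f(t_0) = x_0 and f(t_N) = x_N satisfying f(t) = F_n(L_n⁻¹(t), f(L_n⁻¹(t))) for all t ∈ I_n and all n = 1,…,N. (This unique fixed point is the fractal interpolation function of the data.) -/

import Mathlib

open Set

/-- The affine contraction `L_n : I → I_n` determined by `L_n(t_0) = t_{n-1}`, `L_n(t_N) = t_n`. -/
noncomputable def Lmap (t : ℕ → ℝ) (N n : ℕ) (s : ℝ) : ℝ :=
  t (n - 1) + (t n - t (n - 1)) * (s - t 0) / (t N - t 0)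

/-- The inverse map `L_n⁻¹ : I_n → I`. -/
noncomputable def LmapInv (t : ℕ → ℝ) (N n : ℕ) (y : ℝ) : ℝ :=
  t 0 + (t N - t 0) * (y - t (n - 1)) / (t n - t (n - 1))

theorem LmapInv_left (t : ℕ → ℝ) (N n : ℕ) : LmapInv t N n (t (n - 1)) = t 0 := by
  simp [LmapInv]

theorem LmapInv_right {t : ℕ → ℝ} (N : ℕ) {n : ℕ} (h : t (n - 1) < t n) :
    LmapInv t N n (t n) = t N := by
  have h' : t n - t (n - 1) ≠ 0 := (sub_pos.2 h).ne'
  simp [LmapInv, mul_div_assoc, div_self h']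

theorem continuous_LmapInv (t : ℕ → ℝ) (N n : ℕ) : Continuous (LmapInv t N n) := by
  unfold LmapInv
  fun_prop

theorem monotone_LmapInv {t : ℕ → ℝ} {N n : ℕ} (hN : t 0 ≤ t N) (hn : t (n - 1) ≤ t n) :
    Monotone (LmapInv t N n) := by
  intro u v huv
  have := sub_nonneg.2 hN
  have := sub_nonneg.2 hn
  unfold LmapInv
  gcongr

theorem mapsTo_LmapInv {t : ℕ → ℝ} {N n : ℕ} (hN : t 0 ≤ t N) (hn : t (n - 1) < t n) :
    MapsTo (LmapInv t N n) (Icc (t (n - 1)) (t n)) (Icc (t 0) (t N)) := by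
  intro u hu
  have hm := monotone_LmapInv hN hn.le
  exact ⟨LmapInv_left t N n ▸ hm hu.1, LmapInv_right N hn ▸ hm hu.2⟩

theorem le_of_forall_lt_succ {t : ℕ → ℝ} {N : ℕ} (ht : ∀ i, i < N → t i < t (i + 1))
    {m n : ℕ} (hmn : m ≤ n) (hn : n ≤ N) : t m ≤ t n := by
  induction n, hmn using Nat.le_induction with
  | base => exact le_rfl
  | succ k _ ih => exact (ih (by lia)).trans (ht k (by lia)).le

/-- Every point of `[t 0, t N]` lies in one of the intervals of the partition. -/
theorem exists_mem_Icc_partition {t : ℕ → ℝ} {N : ℕ} (hN : 1 ≤ N) {u : ℝ}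
    (hu : u ∈ Icc (t 0) (t N)) :
    ∃ n, 1 ≤ n ∧ n ≤ N ∧ u ∈ Icc (t (n - 1)) (t n) := by
  induction N, hN using Nat.le_induction with
  | base => exact ⟨1, le_rfl, le_rfl, hu⟩
  | succ k hk ih =>
    rcases le_total u (t k) with h | h
    · obtain ⟨n, h1, h2, h3⟩ := ih ⟨hu.1, h⟩
      exact ⟨n, h1, h2.trans k.le_succ, h3⟩
    · exact ⟨k + 1, by lia, le_rfl, h, hu.2⟩

/-- Continuous functions on the intervals of a partition that interpolate common values at the
nodes glue to a continuous function. -/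
theorem exists_continuousOn_glue {t x : ℕ → ℝ} {N : ℕ} (ht : ∀ i, i < N → t i < t (i + 1))
    {h : ℕ → ℝ → ℝ}
    (hc : ∀ n, 1 ≤ n → n ≤ N → ContinuousOn (h n) (Icc (t (n - 1)) (t n)))
    (hl : ∀ n, 1 ≤ n → n ≤ N → h n (t (n - 1)) = x (n - 1))
    (hr : ∀ n, 1 ≤ n → n ≤ N → h n (t n) = x n) :
    ∃ g : ℝ → ℝ, ContinuousOn g (Icc (t 0) (t N)) ∧ g (t 0) = x 0 ∧ g (t N) = x N ∧
      ∀ n, 1 ≤ n → n ≤ N → EqOn g (h n) (Icc (t (n - 1)) (t n)) := by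
  induction N with
  | zero => exact ⟨fun _ => x 0, continuousOn_const, rfl, rfl, fun n h1 h2 => by lia⟩
  | succ k ih =>
    obtain ⟨g, gc, g0, gk, ge⟩ := ih (fun i hi => ht i (by lia))
      (fun n h1 h2 => hc n h1 (by lia)) (fun n h1 h2 => hl n h1 (by lia))
      (fun n h1 h2 => hr n h1 (by lia))
    have hk : t k < t (k + 1) := ht k (by lia)
    have h0 : t 0 ≤ t k := le_of_forall_lt_succ ht k.zero_le k.le_succ
    have hlk : h (k + 1) (t k) = x k := hl (k + 1) (by lia) le_rfl
    let G : ℝ → ℝ := fun u => if u ≤ t k then g u else h (k + 1) u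
    have hG1 : EqOn G g (Iic (t k)) := fun u hu => if_pos hu
    have hG2 : EqOn G (h (k + 1)) (Ici (t k)) := by
      intro u hu
      rcases eq_or_lt_of_le (mem_Ici.1 hu) with rfl | hlt
      · rw [hG1 self_mem_Iic, gk, hlk]
      · exact if_neg hlt.not_ge
    refine ⟨G, ?_, ?_, ?_, ?_⟩
    · rw [← Icc_union_Icc_eq_Icc h0 hk.le]
      exact (gc.congr (hG1.mono Icc_subset_Iic_self)).union_of_isClosed
        ((hc (k + 1) (by lia) le_rfl).congr (hG2.mono Icc_subset_Ici_self))
        isClosed_Icc isClosed_Icc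
    · rw [hG1 h0, g0]
    · rw [hG2 hk.le, hr (k + 1) (by lia) le_rfl]
    · intro n h1 h2
      rcases Nat.le_succ_iff.1 h2 with h2 | rfl
      · intro u hu
        rw [hG1 (hu.2.trans (le_of_forall_lt_succ ht h2 k.le_succ)), ge n h1 h2 hu]
      · exact hG2.mono Icc_subset_Ici_self

/-- The continuous functions on `[a, b]` with prescribed values at the end points. -/
def endpointMaps {a b : ℝ} (hab : a ≤ b) (y z : ℝ) : Set C(Icc a b, ℝ) :=
  {f | f ⟨a, left_mem_Icc.2 hab⟩ = y ∧ f ⟨b, right_mem_Icc.2 hab⟩ = z}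

theorem isClosed_endpointMaps {a b : ℝ} (hab : a ≤ b) (y z : ℝ) :
    IsClosed (endpointMaps hab y z) :=
  (isClosed_eq (continuous_eval_const _) continuous_const).inter
    (isClosed_eq (continuous_eval_const _) continuous_const)

theorem endpointMaps_nonempty {a b : ℝ} (hab : a < b) (y z : ℝ) :
    (endpointMaps hab.le y z).Nonempty := by
  refine ⟨⟨fun s => y + (z - y) * ((s - a) / (b - a)), by fun_prop⟩, ?_, ?_⟩
  · simp
  · simp [div_self (sub_pos.2 hab).ne']

/-- there is exactly one continuous `f : I → ℝ` with `f(t_0) = x_0`,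
`f(t_N) = x_N` satisfying `f(t) = F_n(L_n⁻¹(t), f(L_n⁻¹(t)))` for all `t ∈ I_n`,
`n = 1,…,N` (uniqueness meaning: any two such functions agree on `I`).  This unique
fixed point of `T` is the fractal interpolation function of the data. -/
theorem fif_exists_unique
    (N : ℕ) (hN : 2 ≤ N) (t x : ℕ → ℝ)
    (ht : ∀ i, i < N → t i < t (i + 1))
    (α : ℕ → ℝ) (q : ℕ → ℝ → ℝ)
    (hα : ∀ n, 1 ≤ n → n ≤ N → |α n| < 1)
    (hq : ∀ n, 1 ≤ n → n ≤ N → ContinuousOn (q n) (Icc (t 0) (t N)))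
    (hend : ∀ n, 1 ≤ n → n ≤ N →
      α n * x 0 + q n (t 0) = x (n - 1) ∧ α n * x N + q n (t N) = x n) :
    ∃ f : ℝ → ℝ,
      (ContinuousOn f (Icc (t 0) (t N)) ∧ f (t 0) = x 0 ∧ f (t N) = x N ∧
        ∀ n, 1 ≤ n → n ≤ N → ∀ u ∈ Icc (t (n - 1)) (t n),
          f u = α n * f (LmapInv t N n u) + q n (LmapInv t N n u)) ∧
      ∀ g : ℝ → ℝ,
        (ContinuousOn g (Icc (t 0) (t N)) ∧ g (t 0) = x 0 ∧ g (t N) = x N ∧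
          ∀ n, 1 ≤ n → n ≤ N → ∀ u ∈ Icc (t (n - 1)) (t n),
            g u = α n * g (LmapInv t N n u) + q n (LmapInv t N n u)) →
        EqOn f g (Icc (t 0) (t N)) := by
  have hlt : ∀ n, 1 ≤ n → n ≤ N → t (n - 1) < t n := fun n h1 h2 => by
    have := ht (n - 1) (by lia)
    rwa [Nat.sub_add_cancel h1] at this
  have hab : t 0 < t N :=
    (ht 0 (by lia)).trans_le (le_of_forall_lt_succ ht (by lia) le_rfl)
  obtain ⟨m, hm, hmax⟩ := Finset.exists_max_image (Finset.Icc 1 N) (fun n => |α n|)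
    ⟨1, Finset.mem_Icc.2 ⟨le_rfl, by lia⟩⟩
  rw [Finset.mem_Icc] at hm
  let S := endpointMaps hab.le (x 0) (x N)
  have hglue : ∀ f : S, ∃ g : S, ∀ n, 1 ≤ n → n ≤ N → ∀ u (hu : u ∈ Icc (t 0) (t N)),
      u ∈ Icc (t (n - 1)) (t n) → g.1 ⟨u, hu⟩ =
        α n * IccExtend hab.le f.1 (LmapInv t N n u) + q n (LmapInv t N n u) := by
    rintro ⟨f, hf0, hfN⟩
    have hE0 : IccExtend hab.le f (t 0) = x 0 := by rw [IccExtend_left, hf0]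
    have hEN : IccExtend hab.le f (t N) = x N := by rw [IccExtend_right, hfN]
    obtain ⟨g, gc, g0, gN, ge⟩ := exists_continuousOn_glue (x := x) ht
      (h := fun n u => α n * IccExtend hab.le f (LmapInv t N n u) + q n (LmapInv t N n u))
      (fun n h1 h2 =>
        (continuous_const.mul
          (f.continuous.Icc_extend'.comp (continuous_LmapInv t N n))).continuousOn.add
          ((hq n h1 h2).comp (continuous_LmapInv t N n).continuousOn
            (mapsTo_LmapInv hab.le (hlt n h1 h2))))
      (fun n h1 h2 => by simp only [LmapInv_left, hE0, (hend n h1 h2).1])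
      (fun n h1 h2 => by simp only [LmapInv_right N (hlt n h1 h2), hEN, (hend n h1 h2).2])
    exact ⟨⟨⟨(Icc (t 0) (t N)).domRestrict g, gc.domRestrict⟩, g0, gN⟩,
      fun n h1 h2 u _ hu => ge n h1 h2 hu⟩
  choose T hT using hglue
  have hcontr : ContractingWith ‖α m‖₊ T := by
    refine ⟨NNReal.coe_lt_coe.1 (hα m hm.1 hm.2), LipschitzWith.of_dist_le_mul fun f g => ?_⟩
    rw [Subtype.dist_eq, ContinuousMap.dist_le (by positivity)]
    rintro ⟨u, hu⟩
    obtain ⟨n, h1, h2, hun⟩ := exists_mem_Icc_partition (by lia) hu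
    rw [hT f n h1 h2 u hu hun, hT g n h1 h2 u hu hun, Real.dist_eq, add_sub_add_right_eq_sub,
      ← mul_sub, abs_mul]
    exact mul_le_mul (hmax n (Finset.mem_Icc.2 ⟨h1, h2⟩))
      (ContinuousMap.dist_apply_le_dist (f := f.1) (g := g.1) _) (abs_nonneg _) (abs_nonneg _)
  have : Nonempty S := (endpointMaps_nonempty hab _ _).to_subtype
  have : CompleteSpace S := (isClosed_endpointMaps hab.le _ _).completeSpace_coe
  obtain ⟨f, hf⟩ : ∃ f : S, Function.IsFixedPt T f := ⟨_, hcontr.fixedPoint_isFixedPt⟩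
  have hsub : ∀ n, 1 ≤ n → n ≤ N → Icc (t (n - 1)) (t n) ⊆ Icc (t 0) (t N) :=
    fun n h1 h2 => Icc_subset_Icc (le_of_forall_lt_succ ht (Nat.zero_le _) (by lia))
      (le_of_forall_lt_succ ht h2 le_rfl)
  refine ⟨IccExtend hab.le f.1, ⟨f.1.continuous.Icc_extend'.continuousOn, ?_, ?_, ?_⟩, ?_⟩
  · rw [IccExtend_left]
    exact f.2.1
  · rw [IccExtend_right]
    exact f.2.2
  · intro n h1 h2 u hu
    rw [← hT f n h1 h2 u (hsub n h1 h2 hu) hu, hf.eq, IccExtend_of_mem]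
  · rintro g ⟨gc, g0, gN, ge⟩
    let g' : S := ⟨⟨(Icc (t 0) (t N)).domRestrict g, gc.domRestrict⟩, g0, gN⟩
    have hg' : Function.IsFixedPt T g' := by
      refine Subtype.ext (ContinuousMap.ext ?_)
      rintro ⟨u, hu⟩
      obtain ⟨n, h1, h2, hun⟩ := exists_mem_Icc_partition (by lia) hu
      rw [hT g' n h1 h2 u hu hun,
        IccExtend_of_mem _ _ (mapsTo_LmapInv hab.le (hlt n h1 h2) hun)]
      exact (ge n h1 h2 u hun).symm
    intro u hu
    rw [IccExtend_of_mem _ _ hu, hcontr.fixedPoint_unique' hf hg']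
    rfl
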